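/- Let 0 < α < 1 and define Ψ_α(t) = E_α(-t^α) and the varying relaxation coefficient r_α(t) = t^{α-1} E_{α,α}(-t^α) / E_α(-t^α) for t > 0. Then for every t > 0, Ψ_α satisfies the first-order differential equation Ψ_α'(t) = -r_α(t) · Ψ_α(t). -/

import Mathlib

/-- The one-parameter Mittag-Leffler function `E_α(x) = ∑ xⁿ / Γ(αn + 1)`. -/
noncomputable def mittagLeffler (α x : ℝ) : ℝ :=
  ∑' n : ℕ, x ^ n / Real.Gamma (α * n + 1)

/-- The two-parameter Mittag-Leffler function `E_{α,β}(x) = ∑ xⁿ / Γ(αn + β)`. -/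
noncomputable def mittagLeffler2 (α β x : ℝ) : ℝ :=
  ∑' n : ℕ, x ^ n / Real.Gamma (α * n + β)

open MeasureTheory Set Filter Topology

/-- A crude superexponential lower bound for the Gamma function. -/
lemma Real.rpow_mul_exp_neg_le_Gamma {R s : ℝ} (hR : 0 < R) (hs : 1 ≤ s) :
    R ^ (s - 1) * Real.exp (-R) ≤ Real.Gamma s := by
  have hint := Real.GammaIntegral_convergent (by linarith : 0 < s)
  have hsub : Ioi R ⊆ Ioi (0 : ℝ) := Ioi_subset_Ioi hR.le
  rw [Real.Gamma_eq_integral (by linarith), ← integral_exp_neg_Ioi, ← integral_const_mul]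
  calc ∫ x in Ioi R, R ^ (s - 1) * Real.exp (-x)
      ≤ ∫ x in Ioi R, Real.exp (-x) * x ^ (s - 1) := by
        refine setIntegral_mono_on ?_ (hint.mono_set hsub) measurableSet_Ioi fun x hx => ?_
        · exact (integrableOn_exp_neg_Ioi R).const_mul _
        · rw [mul_comm]
          have hRx : R ≤ x := (mem_Ioi.1 hx).le
          gcongr
    _ ≤ ∫ x in Ioi (0 : ℝ), Real.exp (-x) * x ^ (s - 1) := by
        refine setIntegral_mono_set hint ?_ hsub.eventuallyLE
        filter_upwards [ae_restrict_mem measurableSet_Ioi] with x hx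
        have : (0 : ℝ) < x := hx
        positivity

/-- The Mittag-Leffler series converges absolutely everywhere. -/
lemma summable_abs_pow_div_Gamma {α β : ℝ} (hα : 0 < α) (hβ : 0 < β) (x : ℝ) :
    Summable fun n : ℕ => |x| ^ n / Real.Gamma (α * n + β) := by
  set R : ℝ := (2 * |x| + 1) ^ (1 / α) with hRdef
  have hR : 0 < R := by positivity
  have hRα : R ^ α = 2 * |x| + 1 := by
    rw [hRdef, ← Real.rpow_mul (by positivity), one_div_mul_cancel hα.ne', Real.rpow_one]
  have hq : |x| / R ^ α < 1 := by
    rw [hRα, div_lt_one (by positivity)]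
    linarith [abs_nonneg x]
  have hgeom := (summable_geometric_of_lt_one (by positivity) hq).mul_left
    (Real.exp R * R ^ (1 - β))
  refine Summable.of_norm_bounded_eventually_nat hgeom ?_
  have hlarge : ∀ᶠ n : ℕ in atTop, 1 ≤ α * n :=
    (tendsto_natCast_atTop_atTop.const_mul_atTop hα).eventually_ge_atTop 1
  filter_upwards [hlarge] with n hn
  have hG : 0 < Real.Gamma (α * n + β) := Real.Gamma_pos_of_pos (by positivity)
  have hlow := Real.rpow_mul_exp_neg_le_Gamma hR (by linarith : 1 ≤ α * n + β)
  rw [Real.norm_of_nonneg (by positivity)]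
  calc |x| ^ n / Real.Gamma (α * n + β)
      ≤ |x| ^ n / (R ^ (α * n + β - 1) * Real.exp (-R)) := by gcongr
    _ = Real.exp R * R ^ (1 - β) * (|x| / R ^ α) ^ n := by
        rw [div_pow, ← Real.rpow_natCast (R ^ α), ← Real.rpow_mul hR.le,
          show α * n + β - 1 = α * n - (1 - β) by ring, Real.rpow_sub hR, Real.exp_neg]
        field_simp

lemma summable_pow_div_Gamma {α β : ℝ} (hα : 0 < α) (hβ : 0 < β) (x : ℝ) :
    Summable fun n : ℕ => x ^ n / Real.Gamma (α * n + β) := by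
  refine Summable.of_norm_bounded (summable_abs_pow_div_Gamma hα hβ x) fun n => ?_
  have hG : 0 < Real.Gamma (α * n + β) := Real.Gamma_pos_of_pos (by positivity)
  rw [norm_div, norm_pow, Real.norm_eq_abs, Real.norm_of_nonneg hG.le]

lemma natCast_mul_pow_div_Gamma_succ {α : ℝ} (hα : 0 < α) (x : ℝ) (n : ℕ) :
    ((n + 1 : ℕ) : ℝ) * x ^ n / Real.Gamma (α * (n + 1 : ℕ) + 1) =
      x ^ n / Real.Gamma (α * n + α) / α := by
  have hpos : 0 < α * (n + 1 : ℕ) := by positivity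
  rw [Real.Gamma_add_one hpos.ne', show α * n + α = α * (n + 1 : ℕ) by push_cast; ring]
  have hG := (Real.Gamma_pos_of_pos hpos).ne'
  have hn : ((n + 1 : ℕ) : ℝ) ≠ 0 := by positivity
  field_simp

lemma hasDerivAt_mittagLeffler {α : ℝ} (hα : 0 < α) (x : ℝ) :
    HasDerivAt (mittagLeffler α) (mittagLeffler2 α α x / α) x := by
  set ρ : ℝ := |x| + 1
  have hρ : 0 < ρ := by positivity
  have hsucc (y : ℝ) (n : ℕ) : ((n + 1 : ℕ) : ℝ) * y ^ (n + 1 - 1) /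
      Real.Gamma (α * (n + 1 : ℕ) + 1) = y ^ n / Real.Gamma (α * n + α) / α := by
    rw [Nat.add_sub_cancel, natCast_mul_pow_div_Gamma_succ hα]
  have hsum (y : ℝ) : Summable fun n : ℕ => (n : ℝ) * y ^ (n - 1) / Real.Gamma (α * n + 1) := by
    rw [← summable_nat_add_iff 1]
    simp_rw [hsucc]
    exact (summable_pow_div_Gamma hα hα y).div_const α
  have hx : x ∈ Metric.ball (0 : ℝ) ρ := by simp [ρ]
  have hderiv := hasDerivAt_tsum_of_isPreconnected
    (g := fun (n : ℕ) (y : ℝ) => y ^ n / Real.Gamma (α * n + 1))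
    (g' := fun (n : ℕ) (y : ℝ) => (n : ℝ) * y ^ (n - 1) / Real.Gamma (α * n + 1))
    (hsum ρ) Metric.isOpen_ball (convex_ball (0 : ℝ) ρ).isPreconnected
    (fun n y _ => (hasDerivAt_pow n y).div_const _)
    (fun n y hy => by
      have hG : 0 < Real.Gamma (α * n + 1) := Real.Gamma_pos_of_pos (by positivity)
      have hy' : |y| ≤ ρ := by simpa using (mem_ball_zero_iff.1 hy).le
      rw [norm_div, norm_mul, norm_pow, Real.norm_eq_abs y, Real.norm_of_nonneg hG.le,
        Real.norm_of_nonneg (Nat.cast_nonneg n)]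
      gcongr)
    hx (summable_pow_div_Gamma hα one_pos x) hx
  refine hderiv.congr_deriv ?_
  rw [(hsum x).tsum_eq_zero_add]
  simp_rw [hsucc]
  simp [mittagLeffler2, tsum_div_const]

lemma mittagLeffler_zero (α : ℝ) : mittagLeffler α 0 = 1 := by
  rw [mittagLeffler, tsum_eq_single 0 fun n hn => by simp [hn]]
  simp

lemma continuous_mittagLeffler_neg_rpow {α : ℝ} (hα : 0 < α) :
    Continuous fun t : ℝ => mittagLeffler α (-(t ^ α)) := by
  have hE : Continuous (mittagLeffler α) :=
    continuous_iff_continuousAt.2 fun x => (hasDerivAt_mittagLeffler hα x).continuousAt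
  exact hE.comp (Real.continuous_rpow_const hα.le).neg

lemma hasDerivAt_mittagLeffler_neg_rpow {α t : ℝ} (hα : 0 < α) (ht : 0 < t) :
    HasDerivAt (fun t : ℝ => mittagLeffler α (-(t ^ α)))
      (-(t ^ (α - 1) * mittagLeffler2 α α (-(t ^ α)))) t := by
  have h := (hasDerivAt_mittagLeffler hα (-(t ^ α))).comp t
    (Real.hasDerivAt_rpow_const (p := α) (Or.inl ht.ne')).neg
  refine h.congr_deriv ?_
  field_simp

/-- The Riemann-Liouville integral of a power. -/
lemma integral_sub_rpow_mul_rpow {a γ t : ℝ} (ha : 0 ≤ a) (hγ : 0 < γ) (ht : 0 < t) :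
    ∫ s in (0 : ℝ)..t, (t - s) ^ (γ - 1) * s ^ a =
      Real.Gamma γ * Real.Gamma (a + 1) * t ^ (a + γ) / Real.Gamma (a + 1 + γ) := by
  have h := Complex.betaIntegral_scaled ((a + 1 : ℝ) : ℂ) (γ : ℂ) ht
  rw [Complex.betaIntegral_eq_Gamma_mul_div _ _ (by simp; linarith) (by simpa)] at h
  have hcast : ((∫ s in (0 : ℝ)..t, (t - s) ^ (γ - 1) * s ^ a : ℝ) : ℂ) =
      ∫ s in (0 : ℝ)..t, (s : ℂ) ^ (((a + 1 : ℝ) : ℂ) - 1) * ((t : ℂ) - s) ^ ((γ : ℂ) - 1) := by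
    rw [← intervalIntegral.integral_ofReal]
    refine intervalIntegral.integral_congr fun s hs => ?_
    rw [uIcc_of_le ht.le] at hs
    have h1 : 0 ≤ t - s := by linarith [hs.2]
    push_cast [Complex.ofReal_cpow h1, Complex.ofReal_cpow hs.1]
    rw [add_sub_cancel_right, mul_comm]
  rw [← hcast, ← Complex.ofReal_add, Complex.Gamma_ofReal, Complex.Gamma_ofReal,
    Complex.Gamma_ofReal, ← Complex.ofReal_one, ← Complex.ofReal_sub,
    ← Complex.ofReal_cpow ht.le] at h
  norm_cast at h
  rw [h, show a + 1 + γ - 1 = a + γ by ring]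
  ring

lemma intervalIntegrable_sub_rpow {γ : ℝ} (hγ : 0 < γ) (t a b : ℝ) :
    IntervalIntegrable (fun s => (t - s) ^ (γ - 1)) volume a b := by
  have h : IntervalIntegrable (fun s : ℝ => s ^ (γ - 1)) volume (t - a) (t - b) :=
    intervalIntegral.intervalIntegrable_rpow' (by linarith)
  simpa using h.comp_sub_left t

/-- Termwise Riemann-Liouville integration of `E_α(-t^α)`. -/
lemma hasSum_integral_sub_rpow_mul_mittagLeffler {α γ t : ℝ} (hα : 0 < α) (hγ : 0 < γ)
    (ht : 0 < t) :
    HasSum (fun n : ℕ => Real.Gamma γ * ((-1) ^ n * t ^ (α * n + γ) /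
        Real.Gamma (α * n + 1 + γ)))
      (∫ s in (0 : ℝ)..t, (t - s) ^ (γ - 1) * mittagLeffler α (-(s ^ α))) := by
  have hker := intervalIntegrable_sub_rpow hγ t 0 t
  have h := intervalIntegral.hasSum_integral_of_dominated_convergence (μ := volume)
    (a := 0) (b := t)
    (F := fun (n : ℕ) (s : ℝ) => (t - s) ^ (γ - 1) * ((-(s ^ α)) ^ n / Real.Gamma (α * n + 1)))
    (f := fun s => (t - s) ^ (γ - 1) * mittagLeffler α (-(s ^ α)))
    (fun (n : ℕ) (s : ℝ) => (t - s) ^ (γ - 1) * (|t ^ α| ^ n / Real.Gamma (α * n + 1)))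
    (fun n => by fun_prop)
    (fun n => Eventually.of_forall fun s hs => by
      rw [uIoc_of_le ht.le] at hs
      have hG : 0 < Real.Gamma (α * n + 1) := Real.Gamma_pos_of_pos (by positivity)
      have h1 : 0 ≤ t - s := by linarith [hs.2]
      have h2 : 0 ≤ s ^ α := Real.rpow_nonneg hs.1.le α
      rw [norm_mul, norm_div, norm_pow, norm_neg, Real.norm_of_nonneg h2,
        Real.norm_of_nonneg hG.le, Real.norm_of_nonneg (Real.rpow_nonneg h1 _),
        abs_of_pos (by positivity)]
      have := hs.1.le
      have := hs.2
      gcongr)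
    (Eventually.of_forall fun s _ => (summable_abs_pow_div_Gamma hα one_pos _).mul_left _)
    (by simpa only [tsum_mul_left] using hker.mul_const _)
    (Eventually.of_forall fun s _ => (summable_pow_div_Gamma hα one_pos _).hasSum.mul_left _)
  refine h.congr_fun fun n => ?_
  have hG : 0 < Real.Gamma (α * n + 1) := Real.Gamma_pos_of_pos (by positivity)
  have hcongr : ∫ s in (0 : ℝ)..t, (t - s) ^ (γ - 1) *
        ((-(s ^ α)) ^ n / Real.Gamma (α * n + 1)) =
      ∫ s in (0 : ℝ)..t, ((-1) ^ n / Real.Gamma (α * n + 1)) *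
        ((t - s) ^ (γ - 1) * s ^ (α * n)) := by
    refine intervalIntegral.integral_congr fun s hs => ?_
    rw [uIcc_of_le ht.le] at hs
    rw [neg_pow, Real.rpow_mul hs.1, Real.rpow_natCast]
    ring
  rw [hcongr, intervalIntegral.integral_const_mul,
    integral_sub_rpow_mul_rpow (by positivity) hγ ht]
  field_simp

/-- The fractional relaxation equation for `E_α(-t^α)`, in integrated form. -/
lemma integral_sub_rpow_neg_mul_mittagLeffler {α t : ℝ} (hα0 : 0 < α) (hα1 : α < 1)
    (ht : 0 < t) :
    ∫ s in (0 : ℝ)..t, (t - s) ^ (-α) * mittagLeffler α (-(s ^ α)) =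
      t ^ (1 - α) / (1 - α) -
        Real.Gamma (1 - α) * ∫ s in (0 : ℝ)..t, mittagLeffler α (-(s ^ α)) := by
  have hγ : 0 < 1 - α := by linarith
  have hA := hasSum_integral_sub_rpow_mul_mittagLeffler hα0 hγ ht
  have hB := hasSum_integral_sub_rpow_mul_mittagLeffler hα0 one_pos ht
  simp only [sub_self, Real.rpow_zero, one_mul, Real.Gamma_one] at hB
  rw [show 1 - α - 1 = -α by ring] at hA
  rw [← hA.tsum_eq, ← hB.tsum_eq, hA.summable.tsum_eq_zero_add, ← tsum_mul_left,
    sub_eq_add_neg (_ / _), ← tsum_neg]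
  congr 1
  · have hG := (Real.Gamma_pos_of_pos hγ).ne'
    rw [Nat.cast_zero, mul_zero, zero_add, zero_add, pow_zero, one_mul, add_comm 1 (1 - α),
      Real.Gamma_add_one hγ.ne']
    field_simp
  · refine tsum_congr fun n => ?_
    rw [show α * (n + 1 : ℕ) + (1 - α) = α * n + 1 by push_cast; ring,
      show α * (n + 1 : ℕ) + 1 + (1 - α) = α * n + 1 + 1 by push_cast; ring, pow_succ]
    ring

/-- At its first zero, a function that is nonnegative before cannot have a convolution with
the kernel `s ^ (-α)` whose derivative is positive. -/
lemma deriv_fractional_integral_nonpos_of_first_zero {α c d t : ℝ} (hα0 : 0 < α) (hα1 : α < 1)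
    {u : ℝ → ℝ} (hu : Continuous u) (ht : 0 < t) (hpos : ∀ s ∈ Icc 0 t, 0 ≤ u s) (hut : u t = 0)
    (hd : HasDerivAt u d t)
    (hc : HasDerivAt (fun x => ∫ s in (0 : ℝ)..x, (x - s) ^ (-α) * u s) c t) : c ≤ 0 := by
  have hint (x a b : ℝ) : IntervalIntegrable (fun s => (x - s) ^ (-α) * u s) volume a b := by
    have h := intervalIntegrable_sub_rpow (by linarith : 0 < 1 - α) x a b
    rw [show 1 - α - 1 = -α by ring] at h
    exact h.mul_continuousOn hu.continuousOn
  obtain ⟨C, hC0, hC⟩ := hd.isBigO_sub.exists_pos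
  obtain ⟨ε, hε, hball⟩ := Metric.eventually_nhds_iff.1 hC.bound
  have hlin : ∀ s, |s - t| < ε → u s ≤ C * |s - t| := fun s hs => by
    have := hball (by simpa [Real.dist_eq] using hs)
    rw [hut, sub_zero, Real.norm_eq_abs, Real.norm_eq_abs] at this
    exact (le_abs_self _).trans this
  have hslope := hc.tendsto_slope.mono_left (nhdsWithin_mono t fun _ hx => (mem_Iio.1 hx).ne)
  have hzero : Tendsto (fun x => C * (t - x) ^ (1 - α)) (𝓝[<] t) (𝓝 0) := by
    have hcont : Continuous fun x : ℝ => C * (t - x) ^ (1 - α) :=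
      continuous_const.mul ((Real.continuous_rpow_const (by linarith)).comp (by fun_prop))
    have := hcont.tendsto t
    rw [sub_self, Real.zero_rpow (by linarith), mul_zero] at this
    exact this.mono_left nhdsWithin_le_nhds
  refine le_of_tendsto_of_tendsto hslope hzero ?_
  have hnear : Ioo (max 0 (t - ε)) t ∈ 𝓝[<] t :=
    Ioo_mem_nhdsLT (max_lt ht (by linarith))
  filter_upwards [hnear] with x hx
  have hx0 : 0 < x := (le_max_left _ _).trans_lt hx.1
  have hxε : t - ε < x := (le_max_right _ _).trans_lt hx.1
  have hxt : 0 < t - x := by linarith [hx.2]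
  have hfirst : ∫ s in (0 : ℝ)..x, (t - s) ^ (-α) * u s ≤
      ∫ s in (0 : ℝ)..x, (x - s) ^ (-α) * u s := by
    refine intervalIntegral.integral_mono_on_of_le_Ioo hx0.le (hint t 0 x) (hint x 0 x)
      fun s hs => ?_
    refine mul_le_mul_of_nonneg_right ?_ (hpos s ⟨hs.1.le, by linarith [hs.2]⟩)
    exact Real.rpow_le_rpow_of_nonpos (by linarith [hs.2]) (by linarith) (by linarith)
  have hsecond : ∫ s in x..t, (t - s) ^ (-α) * u s ≤ ∫ _ in x..t, C * (t - x) ^ (1 - α) := by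
    refine intervalIntegral.integral_mono_on_of_le_Ioo hx.2.le (hint t x t)
      intervalIntegrable_const fun s hs => ?_
    have hst : 0 < t - s := by linarith [hs.2]
    have habs : |s - t| = t - s := by rw [abs_sub_comm, abs_of_pos hst]
    have hus := hlin s (by rw [habs]; linarith [hs.1])
    rw [habs] at hus
    calc (t - s) ^ (-α) * u s ≤ (t - s) ^ (-α) * (C * (t - s)) := by gcongr
      _ = C * (t - s) ^ (1 - α) := by
          rw [sub_eq_add_neg 1 α, Real.rpow_add hst, Real.rpow_one]
          ring
      _ ≤ C * (t - x) ^ (1 - α) := by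
          have hxs := hs.1.le
          gcongr
  rw [intervalIntegral.integral_const, smul_eq_mul] at hsecond
  have hsplit := intervalIntegral.integral_add_adjacent_intervals (hint t 0 x) (hint t x t)
  rw [slope_comm, slope_def_field, div_le_iff₀ hxt]
  linarith

lemma mittagLeffler_neg_rpow_ne_zero {α t : ℝ} (hα0 : 0 < α) (hα1 : α < 1) (ht : 0 < t) :
    mittagLeffler α (-(t ^ α)) ≠ 0 := by
  intro hzero
  set u : ℝ → ℝ := fun t => mittagLeffler α (-(t ^ α)) with hu_def
  have hu : Continuous u := continuous_mittagLeffler_neg_rpow hα0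
  have hu0 : u 0 = 1 := by simp [hu_def, Real.zero_rpow hα0.ne', mittagLeffler_zero]
  set S : Set ℝ := Ici 0 ∩ u ⁻¹' {0}
  have hS : IsClosed S := isClosed_Ici.inter (isClosed_singleton.preimage hu)
  have hbdd : BddBelow S := ⟨0, fun s hs => hs.1⟩
  obtain ⟨hτ0, hτ⟩ : sInf S ∈ S := hS.csInf_mem ⟨t, ht.le, hzero⟩ hbdd
  set τ := sInf S
  have huτ : u τ = 0 := hτ
  have hτpos : 0 < τ := lt_of_le_of_ne hτ0 fun h => by
    rw [← h, hu0] at huτ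
    exact one_ne_zero huτ
  have hnonneg : ∀ s ∈ Icc 0 τ, 0 ≤ u s := by
    intro s hs
    by_contra! hneg
    obtain ⟨z, hz, huz⟩ := intermediate_value_Icc' hs.1 hu.continuousOn
      ⟨hneg.le, hu0 ▸ zero_le_one⟩
    have hzS : τ ≤ z := csInf_le hbdd ⟨hz.1, huz⟩
    have : s = τ := le_antisymm hs.2 (hzS.trans hz.2)
    rw [this, huτ] at hneg
    exact lt_irrefl _ hneg
  have hprim : HasDerivAt (fun x => ∫ s in (0 : ℝ)..x, u s) (u τ) τ :=
    intervalIntegral.integral_hasDerivAt_right (hu.intervalIntegrable _ _)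
      (hu.stronglyMeasurableAtFilter _ _) hu.continuousAt
  have hpow : HasDerivAt (fun x : ℝ => x ^ (1 - α) / (1 - α)) (τ ^ (-α)) τ := by
    have h := (Real.hasDerivAt_rpow_const (p := 1 - α) (Or.inl hτpos.ne')).div_const (1 - α)
    refine h.congr_deriv ?_
    have : 1 - α ≠ 0 := by linarith
    rw [show 1 - α - 1 = -α by ring]
    field_simp
  have hconv : HasDerivAt (fun x => ∫ s in (0 : ℝ)..x, (x - s) ^ (-α) * u s) (τ ^ (-α)) τ := by
    have h := hpow.sub (hprim.const_mul (Real.Gamma (1 - α)))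
    rw [huτ, mul_zero, sub_zero] at h
    refine h.congr_of_eventuallyEq ?_
    filter_upwards [lt_mem_nhds hτpos] with x hx
    exact integral_sub_rpow_neg_mul_mittagLeffler hα0 hα1 hx
  have hle := deriv_fractional_integral_nonpos_of_first_zero hα0 hα1 hu hτpos hnonneg huτ
    (hasDerivAt_mittagLeffler_neg_rpow hα0 hτpos) hconv
  exact (Real.rpow_pos_of_pos hτpos _).not_ge hle

/-- For `0 < α < 1`, the solution `Ψ_α(t) = E_α(-t^α)` of the fractional
relaxation equation satisfies the ordinary relaxation equation
`Ψ_α'(t) = -r_α(t) Ψ_α(t)` with the varying coefficient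
`r_α(t) = t^(α-1) E_{α,α}(-t^α) / E_α(-t^α)`, for every `t > 0`. -/
theorem mittagLeffler_varying_coefficient_ode
    (α : ℝ) (hα0 : 0 < α) (hα1 : α < 1)
    (Ψ r : ℝ → ℝ)
    (hΨ : ∀ t, Ψ t = mittagLeffler α (-(t ^ α)))
    (hr : ∀ t, r t = t ^ (α - 1) * mittagLeffler2 α α (-(t ^ α))
                       / mittagLeffler α (-(t ^ α))) :
    ∀ t : ℝ, 0 < t → HasDerivAt Ψ (-(r t) * Ψ t) t := by
  intro t ht
  have hE := mittagLeffler_neg_rpow_ne_zero hα0 hα1 ht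
  have h := hasDerivAt_mittagLeffler_neg_rpow hα0 ht
  rw [← funext hΨ] at h
  refine h.congr_deriv ?_
  rw [hr, hΨ]
  field_simp
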